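/- Let X and Y be topological spaces and suppose there exists a bijection h : X → Y such that h is θ-weakly discontinuous and the inverse h⁻¹ : Y → X is weakly discontinuous. If Y is wθ-regular, then X is wθ-regular. -/

import Mathlib

open Set Topology TopologicalSpace

universe u v w

/-- A set `U` in a topological space is *θ-open* if each of its points has an open
neighborhood whose closure is contained in `U`. -/
def IsThetaOpen {X : Type*} [TopologicalSpace X] (U : Set X) : Prop :=
  ∀ x ∈ U, ∃ O : Set X, IsOpen O ∧ x ∈ O ∧ closure O ⊆ U

/-- `V` is a θ-open subset of the subspace `A ⊆ X` (with its subspace topology). -/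
def IsThetaOpenIn {X : Type*} [TopologicalSpace X] (V A : Set X) : Prop :=
  V ⊆ A ∧ IsThetaOpen ((Subtype.val ⁻¹' V) : Set A)

/-- `C(f|A)`: the set of points of `A` at which the restriction `f|A : A → Y`
(with `A` carrying the subspace topology) is continuous. -/
def ContPts {X Y : Type*} [TopologicalSpace X] [TopologicalSpace Y] (f : X → Y) (A : Set X) :
    Set X :=
  {x | ∃ hx : x ∈ A, ContinuousAt (A.restrict f) ⟨x, hx⟩}

/-- `f` is scatteredly continuous if for every nonempty `A ⊆ X` the set `C(f|A)` is nonempty. -/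
def ScatteredlyContinuous {X Y : Type*} [TopologicalSpace X] [TopologicalSpace Y]
    (f : X → Y) : Prop :=
  ∀ A : Set X, A.Nonempty → (ContPts f A).Nonempty

/-- `f` is weakly discontinuous if for every nonempty `A ⊆ X` the set `C(f|A)` has
nonempty interior in `A`. -/
def WeaklyDiscontinuous {X Y : Type*} [TopologicalSpace X] [TopologicalSpace Y]
    (f : X → Y) : Prop :=
  ∀ A : Set X, A.Nonempty → (interior ((Subtype.val ⁻¹' ContPts f A) : Set A)).Nonempty

/-- `f` is θ-weakly discontinuous if for every nonempty `A ⊆ X` the set `C(f|A)` contains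
a nonempty θ-open subset of the subspace `A`. -/
def ThetaWeaklyDiscontinuous {X Y : Type*} [TopologicalSpace X] [TopologicalSpace Y]
    (f : X → Y) : Prop :=
  ∀ A : Set X, A.Nonempty → ∃ V : Set X, V.Nonempty ∧ V ⊆ ContPts f A ∧ IsThetaOpenIn V A

/-- `X` is sw-regular if every scatteredly continuous function from any topological space
to `X` is weakly discontinuous. -/
def SwRegular.{t, s} (X : Type s) [TopologicalSpace X] : Prop :=
  ∀ (Z : Type t) (_ : TopologicalSpace Z) (f : Z → X),
    ScatteredlyContinuous f → WeaklyDiscontinuous f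

/-- `X` is wθ-regular if every weakly discontinuous function from `X` to any topological
space is θ-weakly discontinuous. -/
def WThetaRegular.{t, s} (X : Type s) [TopologicalSpace X] : Prop :=
  ∀ (Y : Type t) (_ : TopologicalSpace Y) (f : X → Y),
    WeaklyDiscontinuous f → ThetaWeaklyDiscontinuous f

/-- A bijection (given as an equivalence) is a θ-weak homeomorphism if it and its inverse
are θ-weakly discontinuous. -/
def IsThetaWeakHomeomorph {X Y : Type*} [TopologicalSpace X] [TopologicalSpace Y]
    (e : X ≃ Y) : Prop :=
  ThetaWeaklyDiscontinuous (e : X → Y) ∧ ThetaWeaklyDiscontinuous (e.symm : Y → X)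

/-- A bijection (given as an equivalence) is a weak homeomorphism if it and its inverse
are weakly discontinuous. -/
def IsWeakHomeomorph {X Y : Type*} [TopologicalSpace X] [TopologicalSpace Y]
    (e : X ≃ Y) : Prop :=
  WeaklyDiscontinuous (e : X → Y) ∧ WeaklyDiscontinuous (e.symm : Y → X)

/-- `X` is θ-weakly regular if it is θ-weakly homeomorphic to a regular space. -/
def ThetaWeaklyRegular.{t, s} (X : Type s) [TopologicalSpace X] : Prop :=
  ∃ (Y : Type t) (_ : TopologicalSpace Y), RegularSpace Y ∧
    ∃ e : X ≃ Y, IsThetaWeakHomeomorph e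

/-- `X` is weakly regular if it is weakly homeomorphic to a regular space. -/
def WeaklyRegular.{t, s} (X : Type s) [TopologicalSpace X] : Prop :=
  ∃ (Y : Type t) (_ : TopologicalSpace Y), RegularSpace Y ∧
    ∃ e : X ≃ Y, IsWeakHomeomorph e

theorem mem_contPts_iff {X Y : Type*} [TopologicalSpace X] [TopologicalSpace Y] {f : X → Y}
    {A : Set X} {x : X} : x ∈ ContPts f A ↔ x ∈ A ∧ ContinuousWithinAt f A x := by
  constructor
  · rintro ⟨hx, hc⟩
    exact ⟨hx, (continuousWithinAt_iff_continuousAt_domRestrict f hx).2 hc⟩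
  · rintro ⟨hx, hc⟩
    exact ⟨hx, (continuousWithinAt_iff_continuousAt_domRestrict f hx).1 hc⟩

theorem weaklyDiscontinuous_iff {X Y : Type*} [TopologicalSpace X] [TopologicalSpace Y]
    {f : X → Y} : WeaklyDiscontinuous f ↔ ∀ A : Set X, A.Nonempty →
      ∃ O, IsOpen O ∧ (O ∩ A).Nonempty ∧ ∀ x ∈ O ∩ A, ContinuousWithinAt f A x := by
  refine forall₂_congr fun A _ => ⟨?_, ?_⟩
  · rintro ⟨⟨a, ha⟩, h⟩
    obtain ⟨t, hts, ht, hat⟩ := mem_interior.1 h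
    obtain ⟨O, hO, rfl⟩ := isOpen_induced_iff.1 ht
    exact ⟨O, hO, ⟨a, hat, ha⟩, fun x hx =>
      (mem_contPts_iff.1 (hts (show (⟨x, hx.2⟩ : A) ∈ Subtype.val ⁻¹' O from hx.1))).2⟩
  · rintro ⟨O, hO, ⟨a, haO, haA⟩, h⟩
    exact ⟨⟨a, haA⟩, mem_interior.2 ⟨Subtype.val ⁻¹' O,
      fun x hx => mem_contPts_iff.2 ⟨x.2, h x ⟨hx, x.2⟩⟩,
      hO.preimage continuous_subtype_val, haO⟩⟩

theorem isThetaOpenIn_iff {X : Type*} [TopologicalSpace X] {V A : Set X} :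
    IsThetaOpenIn V A ↔ V ⊆ A ∧
      ∀ x ∈ V, ∃ O, IsOpen O ∧ x ∈ O ∧ closure (O ∩ A) ∩ A ⊆ V := by
  refine and_congr_right fun hVA => ⟨fun h x hx => ?_, fun h x hx => ?_⟩
  · obtain ⟨t, ht, hxt, hcl⟩ := h ⟨x, hVA hx⟩ hx
    obtain ⟨O, hO, rfl⟩ := isOpen_induced_iff.1 ht
    refine ⟨O, hO, hxt, fun y hy => hcl (a := ⟨y, hy.2⟩) (closure_subtype.2 ?_)⟩
    rw [Subtype.image_preimage_coe, inter_comm]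
    exact hy.1
  · obtain ⟨O, hO, hxO, hcl⟩ := h x hx
    refine ⟨Subtype.val ⁻¹' O, hO.preimage continuous_subtype_val, hxO, fun y hy => ?_⟩
    have hy' := closure_subtype.1 hy
    rw [Subtype.image_preimage_coe, inter_comm] at hy'
    exact hcl ⟨hy', y.2⟩

theorem WeaklyDiscontinuous.comp {X Y Z : Type*} [TopologicalSpace X] [TopologicalSpace Y]
    [TopologicalSpace Z] {k : Y → Z} {h : X → Y} (hk : WeaklyDiscontinuous k)
    (hh : WeaklyDiscontinuous h) : WeaklyDiscontinuous (k ∘ h) := by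
  rw [weaklyDiscontinuous_iff] at *
  intro A hA
  obtain ⟨O, hO, hne, hc⟩ := hh A hA
  obtain ⟨W, hW, ⟨_, hyW, ⟨y, hy, rfl⟩⟩, hcW⟩ := hk (h '' (O ∩ A)) (hne.image h)
  have hcont : ContinuousOn h (O ∩ A) := fun x hx => (hc x hx).mono inter_subset_right
  obtain ⟨U, hU, hUeq⟩ := continuousOn_iff'.1 hcont W hW
  refine ⟨U ∩ O, hU.inter hO, ⟨y, ?_⟩, fun x hx => ?_⟩
  · have hyU : y ∈ U ∩ (O ∩ A) := hUeq ▸ ⟨hyW, hy⟩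
    exact ⟨⟨hyU.1, hy.1⟩, hy.2⟩
  · have hxO : x ∈ O ∩ A := ⟨hx.1.2, hx.2⟩
    have hxW : x ∈ h ⁻¹' W ∩ (O ∩ A) := hUeq ▸ ⟨hx.1.1, hxO⟩
    exact ((hcW (h x) ⟨hxW.1, mem_image_of_mem h hxO⟩).comp (hcont x hxO)
      (mapsTo_image h _)).mono_of_mem_nhdsWithin
        (Filter.inter_mem (mem_nhdsWithin_of_mem_nhds (hO.mem_nhds hxO.1)) self_mem_nhdsWithin)

theorem ThetaWeaklyDiscontinuous.comp {X Y Z : Type*} [TopologicalSpace X]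
    [TopologicalSpace Y] [TopologicalSpace Z] {k : Y → Z} {h : X → Y}
    (hk : ThetaWeaklyDiscontinuous k) (hh : ThetaWeaklyDiscontinuous h) :
    ThetaWeaklyDiscontinuous (k ∘ h) := by
  intro A hA
  obtain ⟨V, hVne, hVc, hVθ⟩ := hh A hA
  obtain ⟨W, ⟨w, hw⟩, hWc, hWθ⟩ := hk (h '' V) (hVne.image h)
  obtain ⟨hVA, hV⟩ := isThetaOpenIn_iff.1 hVθ
  obtain ⟨hWV, hW⟩ := isThetaOpenIn_iff.1 hWθ
  have hcont : ContinuousOn h V := fun x hx => (mem_contPts_iff.1 (hVc hx)).2.mono hVA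
  refine ⟨V ∩ h ⁻¹' W, ?_, fun x hx => mem_contPts_iff.2 ⟨hVA hx.1, ?_⟩,
    isThetaOpenIn_iff.2 ⟨inter_subset_left.trans hVA, fun x hx => ?_⟩⟩
  · obtain ⟨v, hv, rfl⟩ := hWV hw
    exact ⟨v, hv, hw⟩
  · obtain ⟨O, hO, hxO, hcl⟩ := hV x hx.1
    refine ((mem_contPts_iff.1 (hWc hx.2)).2.comp (hcont x hx.1)
      (mapsTo_image h V)).mono_of_mem_nhdsWithin ?_
    filter_upwards [mem_nhdsWithin_of_mem_nhds (hO.mem_nhds hxO), self_mem_nhdsWithin]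
      with y hyO hyA
    exact hcl ⟨subset_closure ⟨hyO, hyA⟩, hyA⟩
  · obtain ⟨O, hO, hxO, hcl⟩ := hV x hx.1
    obtain ⟨O', hO', hxO', hcl'⟩ := hW (h x) hx.2
    obtain ⟨U, hU, hUeq⟩ := continuousOn_iff'.1 hcont O' hO'
    have hxU : x ∈ U ∩ V := hUeq ▸ ⟨hxO', hx.1⟩
    refine ⟨U ∩ O, hU.inter hO, ⟨hxU.1, hxO⟩, fun y hy => ?_⟩
    have hyV : y ∈ V :=
      hcl ⟨closure_mono (inter_subset_inter_left A inter_subset_right) hy.1, hy.2⟩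
    have hsub : U ∩ O ∩ A ⊆ U ∩ V := fun z hz =>
      ⟨hz.1.1, hcl ⟨subset_closure ⟨hz.1.2, hz.2⟩, hz.2⟩⟩
    have hmaps : MapsTo h (U ∩ V) (O' ∩ h '' V) := fun z hz =>
      have hz' : z ∈ h ⁻¹' O' ∩ V := hUeq ▸ hz
      ⟨hz'.1, mem_image_of_mem h hz.2⟩
    exact ⟨hyV, hcl' ⟨((hcont y hyV).mono inter_subset_right).mem_closure
      (closure_mono hsub hy.1) hmaps, mem_image_of_mem h hyV⟩⟩

theorem wThetaRegular_of_thetaWeakly_discontinuous_bijection {X : Type u} {Y : Type v}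
    [TopologicalSpace X] [TopologicalSpace Y] (h : X → Y) (g : Y → X)
    (hgl : Function.LeftInverse g h) (hgr : Function.RightInverse g h)
    (hh : ThetaWeaklyDiscontinuous h) (hg : WeaklyDiscontinuous g)
    (hY : WThetaRegular.{w, v} Y) : WThetaRegular.{w, u} X := by
  intro Z _ f hf
  have hfgh := (hY Z _ (f ∘ g) (hf.comp hg)).comp hh
  rwa [Function.comp_assoc, hgl.comp_eq_id, Function.comp_id] at hfgh
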